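/- arXiv:2008.00226 — 9 statements merged into one kernel-verified Lean document; each statement's English description precedes it below -/
import Mathlib

section
/- Let T : ℝ^n → ℝ^n be continuous and d-demicontractive with d ∈ [0,1), and assume Fix(T) is nonempty. Then the fixed-point set Fix(T) is closed and convex. -/
open scoped RealInnerProductSpace

/-- The fixed-point set of a continuous d-demicontractive mapping
(`d ∈ [0,1)`, nonempty fixed-point set) is closed and convex. -/
theorem stmt_2 {n : ℕ} (T : EuclideanSpace ℝ (Fin n) → EuclideanSpace ℝ (Fin n))
    (hcont : Continuous T)
    (d : ℝ) (hd : d ∈ Set.Ico (0 : ℝ) 1)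
    (hFix : ∃ z, T z = z)
    (hT : ∀ x z, T z = z → ‖T x - z‖ ^ 2 ≤ ‖x - z‖ ^ 2 + d * ‖T x - x‖ ^ 2) :
    IsClosed {x | T x = x} ∧ Convex ℝ {x | T x = x} := by
  refine ⟨isClosed_eq hcont continuous_id, ?_⟩
  intro x hx y hy a b ha hb hab
  simp only [Set.mem_ofPred_eq] at hx hy ⊢
  set w := a • x + b • y with hw
  have key : ∀ z, T z = z → (1 - d) * ‖T w - w‖ ^ 2 + 2 * ⟪T w - w, w - z⟫ ≤ 0 := by
    intro z hz
    have h := hT w z hz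
    rw [← sub_add_sub_cancel (T w) w z, norm_add_sq_real] at h
    linarith
  have hcomb : a * ⟪T w - w, w - x⟫ + b * ⟪T w - w, w - y⟫ = 0 := by
    rw [← real_inner_smul_right, ← real_inner_smul_right, ← inner_add_right]
    have hzero : a • (w - x) + b • (w - y) = 0 := by
      rw [smul_sub, smul_sub, sub_add_sub_comm, ← add_smul, hab, one_smul, ← hw, sub_self]
    rw [hzero, inner_zero_right]
  have hle : (1 - d) * ‖T w - w‖ ^ 2 ≤ 0 := by
    have hxa := mul_le_mul_of_nonneg_left (key x hx) ha
    have hyb := mul_le_mul_of_nonneg_left (key y hy) hb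
    have hsum : (a + b) * ((1 - d) * ‖T w - w‖ ^ 2) ≤ 0 := by linarith
    rwa [hab, one_mul] at hsum
  have hsq : ‖T w - w‖ ^ 2 ≤ 0 := nonpos_of_mul_nonpos_right hle (sub_pos.mpr hd.2)
  exact sub_eq_zero.mp (norm_eq_zero.mp (sq_nonpos_iff _ |>.mp hsq))
end

section
/- Let r : ℝ^n → ℝ^n and α > 0, and suppose the mapping T(x) := r(x) − α x is Lipschitz continuous with Lipschitz constant β satisfying 0 < β ≤ α. Then r is co-coercive: there exists a constant c > 0 such that c‖r(x) − r(z)‖² ≤ ⟨r(x) − r(z), x − z⟩ for all x, z ∈ ℝ^n. -/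
open scoped RealInnerProductSpace

/-- If `T(x) = r(x) − α x` is Lipschitz with constant `β`, `0 < β ≤ α`,
then `r` is co-coercive: there is `c > 0` with
`c‖r x − r z‖² ≤ ⟨r x − r z, x − z⟩` for all `x, z`. -/
theorem stmt_4 {n : ℕ} (r : EuclideanSpace ℝ (Fin n) → EuclideanSpace ℝ (Fin n))
    (α β : ℝ) (hα : 0 < α) (hβ : 0 < β) (hβα : β ≤ α)
    (hLip : ∀ x z, ‖(r x - α • x) - (r z - α • z)‖ ≤ β * ‖x - z‖) :
    ∃ c > 0, ∀ x z, c * ‖r x - r z‖ ^ 2 ≤ ⟪r x - r z, x - z⟫ := by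
  refine ⟨(2 * α)⁻¹, by positivity, fun x z => ?_⟩
  have hdiff : (r x - α • x) - (r z - α • z) = (r x - r z) - α • (x - z) := by
    rw [smul_sub]; abel
  have hle : ‖(r x - r z) - α • (x - z)‖ ≤ α * ‖x - z‖ := by
    rw [← hdiff]
    exact (hLip x z).trans (by gcongr)
  have hsq := pow_le_pow_left₀ (norm_nonneg _) hle 2
  rw [norm_sub_sq_real, real_inner_smul_right, norm_smul, Real.norm_of_nonneg hα.le] at hsq
  rw [inv_mul_le_iff₀ (by positivity)]
  linarith
end

section
/- Let f : ℝ^n → ℝ^n be d-demicontractive with d ∈ [0,1), let α ∈ (0, 1 − d), and let f_α := α f + (1 − α) Id. Let a < b and suppose there exists z ∈ Fix(f) with z ∈ [a,b]^n. Then for every x ∈ [a,b]^n, (1/n)‖f_α(x) − x‖² ≤ σ²(α) · c, where σ²(α) := α/(1 − d − α) and c := (b − a)². -/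
open scoped RealInnerProductSpace

/-- Fejér-type estimate for the relaxation of a demicontractive step `u` taken from the
offset `w` to a fixed point. -/
theorem sq_norm_smul_le_of_demicontractive {E : Type*} [NormedAddCommGroup E]
    [InnerProductSpace ℝ E] {u w : E} {d α : ℝ} (hα₀ : 0 < α) (hα₁ : α < 1 - d)
    (h : ‖u + w‖ ^ 2 ≤ ‖w‖ ^ 2 + d * ‖u‖ ^ 2) :
    ‖α • u‖ ^ 2 ≤ α / (1 - d - α) * ‖w‖ ^ 2 := by
  have hpos : 0 < 1 - d - α := by linarith
  have hrelaxed : 0 ≤ ‖α • u + w‖ ^ 2 := sq_nonneg _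
  rw [norm_add_sq_real, real_inner_smul_left, norm_smul, mul_pow, Real.norm_eq_abs,
    sq_abs] at hrelaxed
  rw [norm_add_sq_real] at h
  rw [norm_smul, mul_pow, Real.norm_eq_abs, sq_abs, div_mul_eq_mul_div, le_div_iff₀ hpos]
  have hstep : α * (1 - d - α) * ‖u‖ ^ 2 ≤ ‖w‖ ^ 2 := by
    have := mul_le_mul_of_nonneg_left h hα₀.le
    linarith
  have := mul_le_mul_of_nonneg_left hstep hα₀.le
  linarith

/-- The squared distance between two points of the box `[a,b]^ι`. -/
theorem EuclideanSpace.sq_norm_sub_le_card_mul_sq {ι : Type*} [Fintype ι]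
    {x z : EuclideanSpace ℝ ι} {a b : ℝ} (hx : ∀ i, x i ∈ Set.Icc a b)
    (hz : ∀ i, z i ∈ Set.Icc a b) :
    ‖x - z‖ ^ 2 ≤ Fintype.card ι * (b - a) ^ 2 := by
  rw [EuclideanSpace.norm_sq_eq, ← nsmul_eq_mul]
  refine Finset.sum_le_card_nsmul _ _ _ fun i _ => ?_
  rw [PiLp.sub_apply, Real.norm_eq_abs]
  exact pow_le_pow_left₀ (abs_nonneg _) (abs_sub_le_of_le_of_le (hx i).1 (hx i).2
    (hz i).1 (hz i).2) 2

/-- If `f` is d-demicontractive, `α ∈ (0, 1−d)`, and there is a fixed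
point of `f` in the box `[a,b]^n` (`a < b`), then for every `x ∈ [a,b]^n` the relaxed
operator `f_α = α f + (1−α) Id` satisfies
`(1/n)‖f_α x − x‖² ≤ σ²(α)·c` with `σ²(α) = α/(1−d−α)` and `c = (b−a)²`. -/
theorem stmt_7 {n : ℕ} (f : EuclideanSpace ℝ (Fin n) → EuclideanSpace ℝ (Fin n))
    (d : ℝ) (hd : d ∈ Set.Ico (0 : ℝ) 1)
    (hT : ∀ x z, f z = z → ‖f x - z‖ ^ 2 ≤ ‖x - z‖ ^ 2 + d * ‖f x - x‖ ^ 2)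
    (α : ℝ) (hα : α ∈ Set.Ioo (0 : ℝ) (1 - d))
    (a b : ℝ) (hab : a < b)
    (hz : ∃ z, f z = z ∧ ∀ i, z i ∈ Set.Icc a b) :
    ∀ x : EuclideanSpace ℝ (Fin n), (∀ i, x i ∈ Set.Icc a b) →
      (1 / (n : ℝ)) * ‖(α • f x + (1 - α) • x) - x‖ ^ 2 ≤
        (α / (1 - d - α)) * (b - a) ^ 2 := by
  obtain ⟨z, hfz, hzbox⟩ := hz
  intro x hx
  have hσ : 0 ≤ α / (1 - d - α) := div_nonneg hα.1.le (by linarith [hα.2])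
  have hrelax : (α • f x + (1 - α) • x) - x = α • (f x - x) := by module
  have hstep : ‖α • (f x - x)‖ ^ 2 ≤ α / (1 - d - α) * ‖x - z‖ ^ 2 :=
    sq_norm_smul_le_of_demicontractive hα.1 hα.2 (by simpa using hT x z hfz)
  have hbox := EuclideanSpace.sq_norm_sub_le_card_mul_sq hx hzbox
  rw [Fintype.card_fin] at hbox
  rw [hrelax]
  rcases Nat.eq_zero_or_pos n with rfl | hn
  · simpa using mul_nonneg hσ (sq_nonneg (b - a))
  · have hn' : (0 : ℝ) < n := Nat.cast_pos.mpr hn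
    rw [one_div_mul_eq_div, div_le_iff₀ hn']
    linarith [mul_le_mul_of_nonneg_left hbox hσ]
end

section
/- Let f : ℝ^n → ℝ^n be d-demicontractive with d ∈ [0,1) and assume f(0) = 0. Then for every x ∈ ℝ^n, ⟨x, x − f(x)⟩ = 0 if and only if x ∈ Fix(f). (In particular the RED regularizer ρ_RED(x) = (1/2)⟨x, x − f(x)⟩ vanishes exactly on the fixed-point set of f.) -/
open scoped RealInnerProductSpace

/-- If `f` is d-demicontractive (`d ∈ [0,1)`) and `f 0 = 0`, then for every
`x`, `⟨x, x − f x⟩ = 0` iff `x` is a fixed point of `f`; i.e. the RED regularizer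
`ρ(x) = (1/2)⟨x, x − f x⟩` vanishes exactly on `Fix f`. -/
theorem stmt_8 {n : ℕ} (f : EuclideanSpace ℝ (Fin n) → EuclideanSpace ℝ (Fin n))
    (d : ℝ) (hd : d ∈ Set.Ico (0 : ℝ) 1)
    (hT : ∀ x z, f z = z → ‖f x - z‖ ^ 2 ≤ ‖x - z‖ ^ 2 + d * ‖f x - x‖ ^ 2)
    (h0 : f 0 = 0) :
    ∀ x, ⟪x, x - f x⟫ = 0 ↔ f x = x := by
  intro x
  refine ⟨fun h => ?_, fun h => by simp [h]⟩
  have hx := hT x 0 h0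
  simp only [sub_zero] at hx
  rw [inner_sub_right, real_inner_self_eq_norm_sq] at h
  have hexp := norm_sub_sq_real (f x) x
  rw [real_inner_comm] at hexp
  have hsq : ‖f x - x‖ ^ 2 = 0 := by
    nlinarith [sq_nonneg ‖f x - x‖, hd.2]
  exact sub_eq_zero.mp (norm_eq_zero.mp (pow_eq_zero_iff two_ne_zero |>.mp hsq))
end

section
/- Let f : ℝ^n → ℝ^n be continuous and d-demicontractive with d ∈ [0,1) and Fix(f) nonempty, and let ℓ : ℝ^n → ℝ be convex. Then the RED-PRO problem min ℓ(x) subject to x ∈ Fix(f) is a convex optimization problem: the feasible set Fix(f) is closed and convex, and the set of optimal solutions {x ∈ Fix(f) : ℓ(x) ≤ ℓ(y) for all y ∈ Fix(f)} is convex. -/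
open scoped RealInnerProductSpace

/-- The fixed-point set of a demicontractive map on a real inner product space is convex. -/
theorem convex_fixedPoints_of_demicontractive {E : Type*} [NormedAddCommGroup E]
    [InnerProductSpace ℝ E] {f : E → E} {d : ℝ} (hd : d < 1)
    (hT : ∀ x z, f z = z → ‖f x - z‖ ^ 2 ≤ ‖x - z‖ ^ 2 + d * ‖f x - x‖ ^ 2) :
    Convex ℝ {x | f x = x} := by
  have key : ∀ x z, f z = z → 2 * ⟪f x - x, x - z⟫ + (1 - d) * ‖f x - x‖ ^ 2 ≤ 0 := by
    intro x z hz
    have h := hT x z hz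
    rw [← sub_add_sub_cancel (f x) x z, norm_add_sq_real] at h
    linarith
  intro u hu v hv a b ha hb hab
  set x := a • u + b • v with hx
  have hzero : a * ⟪f x - x, x - u⟫ + b * ⟪f x - x, x - v⟫ = 0 := by
    have hcomb : a • (x - u) + b • (x - v) = 0 := by
      rw [smul_sub, smul_sub, sub_add_sub_comm, ← add_smul, hab, one_smul, hx, sub_self]
    rw [← real_inner_smul_right, ← real_inner_smul_right, ← inner_add_right, hcomb,
      inner_zero_right]
  have hsum := add_nonpos (mul_nonpos_of_nonneg_of_nonpos ha (key x u hu))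
    (mul_nonpos_of_nonneg_of_nonpos hb (key x v hv))
  have hle : (1 - d) * ‖f x - x‖ ^ 2 ≤ 0 := by
    linear_combination hsum - 2 * hzero - (1 - d) * ‖f x - x‖ ^ 2 * hab
  have hsq : ‖f x - x‖ ^ 2 = 0 :=
    le_antisymm (nonpos_of_mul_nonpos_right hle (sub_pos.2 hd)) (sq_nonneg _)
  exact sub_eq_zero.1 (norm_eq_zero.1 (pow_eq_zero_iff two_ne_zero |>.1 hsq))

/-- For a continuous d-demicontractive denoiser `f` (`d ∈ [0,1)`, nonempty
fixed-point set) and a convex objective `ℓ`, the RED-PRO problem `min ℓ(x) s.t. x ∈ Fix f`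
is convex: the feasible set `Fix f` is closed and convex, and the set of optimal
solutions is convex. -/
theorem stmt_9 {n : ℕ} (f : EuclideanSpace ℝ (Fin n) → EuclideanSpace ℝ (Fin n))
    (hcont : Continuous f)
    (d : ℝ) (hd : d ∈ Set.Ico (0 : ℝ) 1)
    (hFix : ∃ z, f z = z)
    (hT : ∀ x z, f z = z → ‖f x - z‖ ^ 2 ≤ ‖x - z‖ ^ 2 + d * ‖f x - x‖ ^ 2)
    (ℓ : EuclideanSpace ℝ (Fin n) → ℝ) (hℓ : ConvexOn ℝ Set.univ ℓ) :
    IsClosed {x | f x = x} ∧ Convex ℝ {x | f x = x} ∧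
      Convex ℝ {x | f x = x ∧ ∀ y, f y = y → ℓ x ≤ ℓ y} := by
  have hconv := convex_fixedPoints_of_demicontractive hd.2 hT
  refine ⟨isClosed_eq hcont continuous_id, hconv, ?_⟩
  rintro x ⟨hx, hxmin⟩ y ⟨hy, hymin⟩ a b ha hb hab
  refine ⟨hconv hx hy ha hb hab, fun w hw => ?_⟩
  calc ℓ (a • x + b • y) ≤ a • ℓ x + b • ℓ y :=
        hℓ.2 (Set.mem_univ x) (Set.mem_univ y) ha hb hab
    _ ≤ a • ℓ w + b • ℓ w := by
        gcongr
        · exact hxmin w hw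
        · exact hymin w hw
    _ = ℓ w := by rw [← add_smul, hab, one_smul]
end

section
/- Let f : ℝ^n → ℝ^n be continuous and d-demicontractive (d ∈ [0,1)) with Fix(f) nonempty, and let ℓ : ℝ^n → ℝ be convex and differentiable with L-Lipschitz gradient ∇ℓ. Let α ∈ (0, (1 − d)/2) and μ ∈ (0, 2/L), and assume Fix(f) ∩ Fix(G_ℓ) ≠ ∅ where G_ℓ := Id − μ∇ℓ. Then the sequence defined by x_{k+1} = f_α(x_k − μ∇ℓ(x_k)), with f_α := α f + (1 − α) Id, converges to a point x* satisfying x* ∈ Fix(f) and ∇ℓ(x*) = 0; in particular x* is an optimal solution of the RED-PRO problem min ℓ(x) subject to x ∈ Fix(f). -/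
open scoped RealInnerProductSpace
open Filter

section ConvexGradient

variable {E : Type*} [NormedAddCommGroup E] [InnerProductSpace ℝ E] [CompleteSpace E]
  {ℓ : E → ℝ} {g : E → E} {L : ℝ}

/-- The derivative of a function along a line, in terms of its gradient. -/
lemma hasDerivAt_comp_line_of_hasGradientAt (hgrad : ∀ x, HasGradientAt ℓ (g x) x) (x v : E)
    (t : ℝ) : HasDerivAt (fun s : ℝ => ℓ (x + s • v)) ⟪g (x + t • v), v⟫ t := by
  have hline : HasDerivAt (fun s : ℝ => x + s • v) v t := by
    simpa using ((hasDerivAt_id t).smul_const v).const_add x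
  have h := (hgrad (x + t • v)).hasFDerivAt.comp_hasDerivAt t hline
  rwa [InnerProductSpace.toDual_apply_apply] at h

/-- The first-order lower bound for a convex function. -/
lemma ConvexOn.add_inner_gradient_le (hconv : ConvexOn ℝ Set.univ ℓ)
    (hgrad : ∀ x, HasGradientAt ℓ (g x) x) (x y : E) :
    ℓ x + ⟪g x, y - x⟫ ≤ ℓ y := by
  have hline : ConvexOn ℝ Set.univ (fun s : ℝ => ℓ (x + s • (y - x))) := by
    refine ⟨convex_univ, fun s _ t _ a b ha hb hab => ?_⟩
    have h := hconv.2 (Set.mem_univ (x + s • (y - x))) (Set.mem_univ (x + t • (y - x))) ha hb hab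
    convert h using 2
    obtain rfl : b = 1 - a := by linarith
    simp only [smul_eq_mul]
    module
  have hderiv := hasDerivAt_comp_line_of_hasGradientAt hgrad x (y - x) 0
  have h := hline.le_slope_of_hasDerivAt (Set.mem_univ 0) (Set.mem_univ 1) one_pos hderiv
  simp [slope_def_field] at h
  linarith

/-- The descent lemma for a function with Lipschitz gradient. -/
lemma le_add_inner_gradient_add_sq (hgrad : ∀ x, HasGradientAt ℓ (g x) x)
    (hLip : ∀ x z, ‖g x - g z‖ ≤ L * ‖x - z‖) (x y : E) :
    ℓ y ≤ ℓ x + ⟪g x, y - x⟫ + L / 2 * ‖y - x‖ ^ 2 := by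
  set v := y - x with hv
  have hderiv (t : ℝ) : HasDerivAt
      (fun s : ℝ => ℓ (x + s • v) - (s * ⟪g x, v⟫ + s ^ 2 * (L / 2 * ‖v‖ ^ 2)))
      (⟪g (x + t • v), v⟫ - (⟪g x, v⟫ + 2 * t * (L / 2 * ‖v‖ ^ 2))) t := by
    refine (hasDerivAt_comp_line_of_hasGradientAt hgrad x v t).sub (HasDerivAt.add ?_ ?_)
    · simpa using (hasDerivAt_id t).mul_const ⟪g x, v⟫
    · simpa using (hasDerivAt_pow 2 t).mul_const (L / 2 * ‖v‖ ^ 2)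
  have hanti := antitoneOn_of_deriv_nonpos (convex_Icc (0 : ℝ) 1)
    (fun t _ => (hderiv t).continuousAt.continuousWithinAt)
    (fun t _ => (hderiv t).differentiableAt.differentiableWithinAt)
    (fun t ht => by
      rw [interior_Icc] at ht
      rw [(hderiv t).deriv]
      have hinner := real_inner_le_norm (g (x + t • v) - g x) v
      have hnorm := hLip (x + t • v) x
      rw [add_sub_cancel_left, norm_smul, Real.norm_of_nonneg ht.1.le] at hnorm
      rw [inner_sub_left] at hinner
      nlinarith [mul_le_mul_of_nonneg_right hnorm (norm_nonneg v)])
  have h := hanti (Set.left_mem_Icc.2 zero_le_one) (Set.right_mem_Icc.2 zero_le_one) zero_le_one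
  simp [hv] at h
  linarith

/-- The first-order lower bound for a convex function with Lipschitz gradient, improved by the
distance of the gradients. -/
lemma ConvexOn.add_inner_gradient_add_sq_le (hconv : ConvexOn ℝ Set.univ ℓ)
    (hgrad : ∀ x, HasGradientAt ℓ (g x) x) (hL : 0 < L)
    (hLip : ∀ x z, ‖g x - g z‖ ≤ L * ‖x - z‖) (x y : E) :
    ℓ x + ⟪g x, y - x⟫ + 1 / (2 * L) * ‖g y - g x‖ ^ 2 ≤ ℓ y := by
  set w := g y - g x with hw
  have hlower := hconv.add_inner_gradient_le hgrad x (y - L⁻¹ • w)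
  have hupper := le_add_inner_gradient_add_sq hgrad hLip y (y - L⁻¹ • w)
  have hinner : ⟪g y, w⟫ - ⟪g x, w⟫ = ‖w‖ ^ 2 := by
    rw [← inner_sub_left, ← hw, real_inner_self_eq_norm_sq]
  rw [show y - L⁻¹ • w - x = (y - x) - L⁻¹ • w by abel, inner_sub_right, inner_smul_right] at hlower
  rw [show y - L⁻¹ • w - y = -(L⁻¹ • w) by abel, inner_neg_right, inner_smul_right, norm_neg,
    norm_smul, Real.norm_of_nonneg (inv_nonneg.2 hL.le)] at hupper
  have hcoef : L⁻¹ * (⟪g y, w⟫ - ⟪g x, w⟫) - L / 2 * (L⁻¹ * ‖w‖) ^ 2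
      = 1 / (2 * L) * ‖w‖ ^ 2 := by
    rw [hinner]
    field_simp
    ring
  linarith

/-- **Baillon–Haddad**: the gradient of a convex function, if `L`-Lipschitz, is
`1 / L`-cocoercive. -/
lemma ConvexOn.gradient_cocoercive (hconv : ConvexOn ℝ Set.univ ℓ)
    (hgrad : ∀ x, HasGradientAt ℓ (g x) x) (hL : 0 < L)
    (hLip : ∀ x z, ‖g x - g z‖ ≤ L * ‖x - z‖) (x y : E) :
    1 / L * ‖g x - g y‖ ^ 2 ≤ ⟪g x - g y, x - y⟫ := by
  have hxy := hconv.add_inner_gradient_add_sq_le hgrad hL hLip x y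
  have hyx := hconv.add_inner_gradient_add_sq_le hgrad hL hLip y x
  rw [norm_sub_rev (g y)] at hxy
  rw [← neg_sub x y, inner_neg_right] at hxy
  rw [inner_sub_left]
  have hcoef : 1 / L * ‖g x - g y‖ ^ 2 = 2 * (1 / (2 * L) * ‖g x - g y‖ ^ 2) := by
    field_simp
  linarith

/-- A gradient step decreases the distance to every stationary point. -/
lemma ConvexOn.norm_gradient_step_sub_sq_le (hconv : ConvexOn ℝ Set.univ ℓ)
    (hgrad : ∀ x, HasGradientAt ℓ (g x) x) (hL : 0 < L)
    (hLip : ∀ x z, ‖g x - g z‖ ≤ L * ‖x - z‖) {μ : ℝ} (hμ : 0 ≤ μ) (x : E) {z : E}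
    (hz : g z = 0) :
    ‖x - μ • g x - z‖ ^ 2 ≤ ‖x - z‖ ^ 2 - μ * (2 / L - μ) * ‖g x‖ ^ 2 := by
  have hcoc := hconv.gradient_cocoercive hgrad hL hLip x z
  rw [hz, sub_zero] at hcoc
  rw [show x - μ • g x - z = (x - z) - μ • g x by abel, norm_sub_sq_real, inner_smul_right,
    norm_smul, Real.norm_of_nonneg hμ, real_inner_comm]
  have hcoef : 2 / L = 2 * (1 / L) := by ring
  rw [hcoef]
  nlinarith [mul_le_mul_of_nonneg_left hcoc hμ]

end ConvexGradient

/-- A relaxed step of a demicontractive operator decreases the distance to a fixed point. -/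
lemma norm_relaxed_step_sub_sq_le {E : Type*} [NormedAddCommGroup E] [InnerProductSpace ℝ E]
    {d α : ℝ} (hα : 0 ≤ α) {y fy z : E}
    (hdemi : ‖fy - z‖ ^ 2 ≤ ‖y - z‖ ^ 2 + d * ‖fy - y‖ ^ 2) :
    ‖α • fy + (1 - α) • y - z‖ ^ 2 ≤ ‖y - z‖ ^ 2 - α * (1 - d - α) * ‖fy - y‖ ^ 2 := by
  have hsplit : fy - z = (y - z) + (fy - y) := by abel
  rw [hsplit, norm_add_sq_real] at hdemi
  rw [show α • fy + (1 - α) • y - z = (y - z) + α • (fy - y) by module, norm_add_sq_real,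
    inner_smul_right, norm_smul, Real.norm_of_nonneg hα]
  nlinarith [mul_le_mul_of_nonneg_left hdemi hα]

/-- A Fejér monotone sequence in a proper space converges to a point of the set, if the set is
nonempty and contains all its subsequential limits. -/
lemma exists_tendsto_of_fejer_monotone {X : Type*} [PseudoMetricSpace X] [ProperSpace X]
    {S : Set X} (hS : S.Nonempty) {x : ℕ → X} (hx : ∀ z ∈ S, Antitone fun k => dist (x k) z)
    (hlim : ∀ z, ∀ φ : ℕ → ℕ, StrictMono φ → Tendsto (x ∘ φ) atTop (nhds z) → z ∈ S) :
    ∃ z ∈ S, Tendsto x atTop (nhds z) := by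
  obtain ⟨z₀, hz₀⟩ := hS
  obtain ⟨z, -, φ, hφ, hz⟩ := (isCompact_closedBall z₀ (dist (x 0) z₀)).tendsto_subseq
    (fun k => hx z₀ hz₀ (Nat.zero_le k))
  refine ⟨z, hlim z φ hφ hz, tendsto_iff_dist_tendsto_zero.2 ?_⟩
  exact (tendsto_iff_tendsto_subseq_of_antitone (hx z (hlim z φ hφ hz)) hφ.tendsto_atTop).2
    (tendsto_iff_dist_tendsto_zero.1 hz)

/-- If a nonnegative sequence decreases by at least a positive multiple of `‖u k‖ ^ 2` at each
step, then `u` tends to zero. -/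
lemma tendsto_zero_of_mul_norm_sq_le_sub {E : Type*} [SeminormedAddCommGroup E] {a : ℕ → ℝ}
    {u : ℕ → E} {c : ℝ} (hc : 0 < c) (ha : ∀ k, 0 ≤ a k)
    (hu : ∀ k, c * ‖u k‖ ^ 2 ≤ a k - a (k + 1)) : Tendsto u atTop (nhds 0) := by
  have hanti : Antitone a := antitone_nat_of_succ_le fun k => by
    nlinarith [hu k, mul_nonneg hc.le (sq_nonneg ‖u k‖)]
  have hconv := tendsto_atTop_ciInf hanti ⟨0, Set.forall_mem_range.2 ha⟩
  have hdiff : Tendsto (fun k => (a k - a (k + 1)) / c) atTop (nhds 0) := by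
    simpa using (hconv.sub (hconv.comp (tendsto_add_atTop_nat 1))).div_const c
  have hsq : Tendsto (fun k => ‖u k‖ ^ 2) atTop (nhds 0) :=
    squeeze_zero (fun _ => sq_nonneg _)
      (fun k => by rw [le_div_iff₀ hc]; linarith [hu k]) hdiff
  refine tendsto_zero_iff_norm_tendsto_zero.2 ?_
  simpa using hsq.sqrt

open Filter

/-- Convergence of the fixed-step hybrid steepest descent iteration
`x_{k+1} = f_α(x_k − μ∇ℓ(x_k))` with `μ ∈ (0, 2/L)`, `α ∈ (0, (1−d)/2)`, for a
continuous d-demicontractive denoiser `f` and a convex differentiable `ℓ` with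
L-Lipschitz gradient `g`, assuming `Fix f ∩ Fix(Id − μ∇ℓ) ≠ ∅` (i.e. there is a
fixed point of `f` where the gradient vanishes): the sequence converges to a point
`x*` with `f x* = x*` and `∇ℓ(x*) = 0`; in particular `x*` minimizes `ℓ` over `Fix f`. -/
theorem stmt_11 {n : ℕ}
    (f g : EuclideanSpace ℝ (Fin n) → EuclideanSpace ℝ (Fin n))
    (ℓ : EuclideanSpace ℝ (Fin n) → ℝ) (d L : ℝ)
    (hd : d ∈ Set.Ico (0 : ℝ) 1)
    (hcont : Continuous f)
    (hFix : ∃ z, f z = z)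
    (hdemi : ∀ x z, f z = z → ‖f x - z‖ ^ 2 ≤ ‖x - z‖ ^ 2 + d * ‖f x - x‖ ^ 2)
    (hconv : ConvexOn ℝ Set.univ ℓ)
    (hgrad : ∀ x, HasGradientAt ℓ (g x) x)
    (hL : 0 < L)
    (hLip : ∀ x z, ‖g x - g z‖ ≤ L * ‖x - z‖)
    (α : ℝ) (hα : α ∈ Set.Ioo (0 : ℝ) ((1 - d) / 2))
    (μ : ℝ) (hμ : μ ∈ Set.Ioo (0 : ℝ) (2 / L))
    (hmeet : ∃ z, f z = z ∧ g z = 0)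
    (x : ℕ → EuclideanSpace ℝ (Fin n))
    (hx : ∀ k, x (k + 1) =
      α • f (x k - μ • g (x k)) + (1 - α) • (x k - μ • g (x k))) :
    ∃ xstar, Tendsto x atTop (nhds xstar) ∧ f xstar = xstar ∧ g xstar = 0 ∧
      ∀ y, f y = y → ℓ xstar ≤ ℓ y := by
  obtain ⟨hα0, hα1⟩ := hα
  obtain ⟨hμ0, hμ1⟩ := hμ
  have hcg : 0 < μ * (2 / L - μ) := mul_pos hμ0 (by linarith)
  have hcf : 0 < α * (1 - d - α) := mul_pos hα0 (by linarith)
  have hstep (z) (hz : f z = z ∧ g z = 0) (k : ℕ) :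
      ‖x (k + 1) - z‖ ^ 2 ≤ ‖x k - z‖ ^ 2 - μ * (2 / L - μ) * ‖g (x k)‖ ^ 2
        - α * (1 - d - α) * ‖f (x k - μ • g (x k)) - (x k - μ • g (x k))‖ ^ 2 := by
    rw [hx k]
    have hrelax := norm_relaxed_step_sub_sq_le hα0.le (hdemi (x k - μ • g (x k)) z hz.1)
    have hgstep := hconv.norm_gradient_step_sub_sq_le hgrad hL hLip hμ0.le (x k) hz.2
    linarith
  obtain ⟨z₀, hz₀⟩ := hmeet
  have hg0 : Tendsto (fun k => g (x k)) atTop (nhds 0) :=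
    tendsto_zero_of_mul_norm_sq_le_sub hcg (fun k => sq_nonneg ‖x k - z₀‖) fun k => by
      linarith [hstep z₀ hz₀ k,
        mul_nonneg hcf.le (sq_nonneg ‖f (x k - μ • g (x k)) - (x k - μ • g (x k))‖)]
  have hf0 : Tendsto (fun k => f (x k - μ • g (x k)) - (x k - μ • g (x k))) atTop (nhds 0) :=
    tendsto_zero_of_mul_norm_sq_le_sub hcf (fun k => sq_nonneg ‖x k - z₀‖) fun k => by
      linarith [hstep z₀ hz₀ k, mul_nonneg hcg.le (sq_nonneg ‖g (x k)‖)]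
  have hgcont : Continuous g :=
    (LipschitzWith.of_dist_le' fun x z => by simpa [dist_eq_norm] using hLip x z).continuous
  obtain ⟨z, ⟨hfz, hgz⟩, hz⟩ := exists_tendsto_of_fejer_monotone
    (S := {z | f z = z ∧ g z = 0}) ⟨z₀, hz₀⟩ (x := x)
    (fun z hz => antitone_nat_of_succ_le fun k => by
      rw [dist_eq_norm, dist_eq_norm]
      refine le_of_sq_le_sq ?_ (norm_nonneg _)
      linarith [hstep z hz k, mul_nonneg hcg.le (sq_nonneg ‖g (x k)‖),
        mul_nonneg hcf.le (sq_nonneg ‖f (x k - μ • g (x k)) - (x k - μ • g (x k))‖)])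
    (fun z φ hφ hz => by
      have hgz : g z = 0 := tendsto_nhds_unique ((hgcont.tendsto z).comp hz)
        (hg0.comp hφ.tendsto_atTop)
      have hres : Continuous fun y => f (y - μ • g y) - (y - μ • g y) := by fun_prop
      have hfz := tendsto_nhds_unique ((hres.tendsto z).comp hz) (hf0.comp hφ.tendsto_atTop)
      simp only [hgz, smul_zero, sub_zero] at hfz
      exact ⟨sub_eq_zero.1 hfz, hgz⟩)
  refine ⟨z, hz, hfz, hgz, fun y _ => ?_⟩
  simpa [hgz] using hconv.add_inner_gradient_le hgrad z y
end

section
/- Let T₁, T₂ : ℝ^n → ℝ^n be strongly quasi-nonexpansive with constants γ₁ > 0 and γ₂ > 0 respectively, and assume Fix(T₁) ∩ Fix(T₂) ≠ ∅. Then the composition T := T₁ ∘ T₂ is γ-strongly quasi-nonexpansive with γ = γ₁γ₂/(γ₁ + γ₂), and Fix(T₁ ∘ T₂) = Fix(T₁) ∩ Fix(T₂). -/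
open scoped RealInnerProductSpace

/-- The harmonic weight `c * d / (c + d)` satisfies
`(c * d / (c + d)) * ‖u + v‖ ^ 2 ≤ c * ‖u‖ ^ 2 + d * ‖v‖ ^ 2`. -/
theorem harmonic_mul_norm_add_sq_le {E : Type*} [SeminormedAddCommGroup E] {c d : ℝ}
    (hc : 0 < c) (hd : 0 < d) (u v : E) :
    c * d / (c + d) * ‖u + v‖ ^ 2 ≤ c * ‖u‖ ^ 2 + d * ‖v‖ ^ 2 := by
  have h : ‖u + v‖ ^ 2 ≤ (‖u‖ + ‖v‖) ^ 2 := by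
    gcongr
    exact norm_add_le u v
  have h' : c * d * ‖u + v‖ ^ 2 ≤ c * d * (‖u‖ + ‖v‖) ^ 2 := by gcongr
  rw [div_mul_eq_mul_div, div_le_iff₀ (by positivity)]
  linarith [sq_nonneg (c * ‖u‖ - d * ‖v‖)]

/-- If `T₁, T₂` are strongly quasi-nonexpansive with constants
`γ₁, γ₂ > 0` and `Fix T₁ ∩ Fix T₂ ≠ ∅`, then `T₁ ∘ T₂` is
`γ₁γ₂/(γ₁+γ₂)`-strongly quasi-nonexpansive and
`Fix(T₁ ∘ T₂) = Fix T₁ ∩ Fix T₂`. -/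
theorem stmt_13 {n : ℕ}
    (T₁ T₂ : EuclideanSpace ℝ (Fin n) → EuclideanSpace ℝ (Fin n))
    (γ₁ γ₂ : ℝ) (hγ₁ : 0 < γ₁) (hγ₂ : 0 < γ₂)
    (hT₁ : ∀ x z, T₁ z = z → ‖T₁ x - z‖ ^ 2 ≤ ‖x - z‖ ^ 2 - γ₁ * ‖T₁ x - x‖ ^ 2)
    (hT₂ : ∀ x z, T₂ z = z → ‖T₂ x - z‖ ^ 2 ≤ ‖x - z‖ ^ 2 - γ₂ * ‖T₂ x - x‖ ^ 2)
    (hmeet : ∃ z, T₁ z = z ∧ T₂ z = z) :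
    (∀ x z, T₁ z = z ∧ T₂ z = z →
      ‖T₁ (T₂ x) - z‖ ^ 2 ≤
        ‖x - z‖ ^ 2 - (γ₁ * γ₂ / (γ₁ + γ₂)) * ‖T₁ (T₂ x) - x‖ ^ 2) ∧
    {x | T₁ (T₂ x) = x} = {x | T₁ x = x} ∩ {x | T₂ x = x} := by
  refine ⟨fun x z ⟨hz₁, hz₂⟩ => ?_, Set.ext fun x => ⟨fun hx => ?_, fun ⟨h₁, h₂⟩ => ?_⟩⟩
  · have h := harmonic_mul_norm_add_sq_le hγ₁ hγ₂ (T₁ (T₂ x) - T₂ x) (T₂ x - x)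
    rw [sub_add_sub_cancel] at h
    linarith [hT₁ (T₂ x) z hz₁, hT₂ x z hz₂]
  · obtain ⟨z, hz₁, hz₂⟩ := hmeet
    have hx : T₁ (T₂ x) = x := hx
    have h₁ := hT₁ (T₂ x) z hz₁
    rw [hx] at h₁
    have hsq : γ₂ * ‖T₂ x - x‖ ^ 2 ≤ 0 := by
      have : 0 ≤ γ₁ * ‖x - T₂ x‖ ^ 2 := by positivity
      linarith [hT₂ x z hz₂]
    have h₂ : T₂ x = x := by
      by_contra hne
      have : 0 < ‖T₂ x - x‖ := norm_pos_iff.2 (sub_ne_zero.2 hne)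
      exact hsq.not_gt (by positivity)
    exact ⟨by rwa [h₂] at hx, h₂⟩
  · have h₁ : T₁ x = x := h₁
    have h₂ : T₂ x = x := h₂
    change T₁ (T₂ x) = x
    rw [h₂, h₁]
end

section
/- Let f : ℝ^n → ℝ^n be continuous and d-demicontractive with d ∈ [0,1) and Fix(f) nonempty, let ε > 0 and α ∈ (0, (1 − d)/2], and let δ ∈ [0, αε]. Then B_δ(f) ⊆ Fix_ε(f), i.e., every x ∈ ℝ^n with dist(x, Fix(f)) ≤ δ satisfies ‖x − f(x)‖ ≤ ε. Equivalently, α‖x − f(x)‖ ≤ dist(x, Fix(f)) for all x ∈ ℝ^n. -/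
open scoped RealInnerProductSpace

/-- The residual of a demicontractive map at `x` is controlled by the distance from `x` to any
fixed point `z`. -/
theorem one_sub_mul_norm_sub_le_of_demicontractive {E : Type*} [SeminormedAddCommGroup E]
    {d : ℝ} {x y z : E} (h : ‖y - z‖ ^ 2 ≤ ‖x - z‖ ^ 2 + d * ‖y - x‖ ^ 2) :
    (1 - d) * ‖y - x‖ ≤ 2 * ‖x - z‖ := by
  have htri : (‖y - x‖ - ‖x - z‖) ^ 2 ≤ ‖y - z‖ ^ 2 := by
    refine sq_le_sq' ?_ ?_
    · linarith [norm_sub_le_norm_sub_add_norm_sub x y z, norm_sub_rev x y]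
    · linarith [norm_sub_le_norm_sub_add_norm_sub y z x, norm_sub_rev z x]
  rcases (norm_nonneg (y - x)).eq_or_lt with h0 | hpos
  · rw [← h0, mul_zero]
    positivity
  · refine le_of_mul_le_mul_right ?_ hpos
    linarith

/-- For a continuous d-demicontractive `f` (`d ∈ [0,1)`, nonempty
fixed-point set), `ε > 0`, `α ∈ (0, (1−d)/2]` and `δ ∈ [0, αε]`:
`α‖x − f x‖ ≤ dist(x, Fix f)` for every `x`, and consequently every `x` with
`dist(x, Fix f) ≤ δ` satisfies `‖x − f x‖ ≤ ε`, i.e. `B_δ(f) ⊆ Fix_ε(f)`. -/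
theorem stmt_15 {n : ℕ}
    (f : EuclideanSpace ℝ (Fin n) → EuclideanSpace ℝ (Fin n))
    (hcont : Continuous f)
    (d : ℝ) (hd : d ∈ Set.Ico (0 : ℝ) 1)
    (hFix : ∃ z, f z = z)
    (hdemi : ∀ x z, f z = z → ‖f x - z‖ ^ 2 ≤ ‖x - z‖ ^ 2 + d * ‖f x - x‖ ^ 2)
    (ε : ℝ) (hε : 0 < ε)
    (α : ℝ) (hα : α ∈ Set.Ioc (0 : ℝ) ((1 - d) / 2))
    (δ : ℝ) (hδ : δ ∈ Set.Icc (0 : ℝ) (α * ε)) :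
    (∀ x, α * ‖x - f x‖ ≤ Metric.infDist x {z | f z = z}) ∧
    (∀ x, Metric.infDist x {z | f z = z} ≤ δ → ‖x - f x‖ ≤ ε) := by
  have key : ∀ x, α * ‖x - f x‖ ≤ Metric.infDist x {z | f z = z} := by
    intro x
    refine (Metric.le_infDist (s := {z | f z = z}) hFix).2 fun z hz => ?_
    have h := one_sub_mul_norm_sub_le_of_demicontractive (hdemi x z hz)
    have hle := mul_le_mul_of_nonneg_right hα.2 (norm_nonneg (f x - x))
    rw [norm_sub_rev x (f x), dist_eq_norm]
    linarith
  exact ⟨key, fun x hx => le_of_mul_le_mul_left ((key x).trans (hx.trans hδ.2)) hα.1⟩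
end

section
/- Let f : ℝ^n → ℝ^n be cyclically firmly nonexpansive, and let A := Id − f be the displacement mapping. Then A is cyclically monotone: for every m ≥ 2 and every set of points x₁, …, x_m ∈ ℝ^n (with the convention x_{m+1} = x₁), Σ_{i=1}^{m} ⟨A(x_i), x_{i+1} − x_i⟩ ≤ 0. -/
open scoped RealInnerProductSpace

theorem real_inner_sub_self_le_half_sub_norm_sq {E : Type*} [NormedAddCommGroup E]
    [InnerProductSpace ℝ E] (a b : E) : ⟪a, b - a⟫ ≤ (‖b‖ ^ 2 - ‖a‖ ^ 2) / 2 := by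
  have h := norm_sub_sq_real b a
  rw [inner_sub_right, real_inner_self_eq_norm_sq]
  nlinarith [sq_nonneg ‖b - a‖, real_inner_comm a b]

/-- If `f` is cyclically firmly nonexpansive, then the displacement
mapping `A = Id − f` is cyclically monotone: for every `m ≥ 2` and every cycle
`x₀, …, x_{m−1}` (indexed so that `x m = x 0`),
`Σ_{i<m} ⟨A(x_i), x_{i+1} − x_i⟩ ≤ 0`. -/
theorem stmt_17 {n : ℕ}
    (f : EuclideanSpace ℝ (Fin n) → EuclideanSpace ℝ (Fin n))
    (hf : ∀ m : ℕ, 2 ≤ m → ∀ x : ℕ → EuclideanSpace ℝ (Fin n), x m = x 0 →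
      0 ≤ ∑ i ∈ Finset.range m, ⟪x i - f (x i), f (x i) - f (x (i + 1))⟫) :
    ∀ m : ℕ, 2 ≤ m → ∀ x : ℕ → EuclideanSpace ℝ (Fin n), x m = x 0 →
      ∑ i ∈ Finset.range m, ⟪x i - f (x i), x (i + 1) - x i⟫ ≤ 0 := by
  intro m hm x hx
  have hle : ∀ i ∈ Finset.range m, ⟪x i - f (x i), x (i + 1) - x i⟫ ≤
      (‖x (i + 1) - f (x (i + 1))‖ ^ 2 - ‖x i - f (x i)‖ ^ 2) / 2 -
        ⟪x i - f (x i), f (x i) - f (x (i + 1))⟫ := by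
    intro i _
    have hsplit : x (i + 1) - x i = ((x (i + 1) - f (x (i + 1))) - (x i - f (x i))) -
        (f (x i) - f (x (i + 1))) := by abel
    rw [hsplit, inner_sub_right]
    gcongr
    exact real_inner_sub_self_le_half_sub_norm_sq _ _
  refine (Finset.sum_le_sum hle).trans ?_
  rw [Finset.sum_sub_distrib, ← Finset.sum_div,
    Finset.sum_range_sub (fun i => ‖x i - f (x i)‖ ^ 2) m, hx]
  simpa using hf m hm x hx
end
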